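/- Let γ ≥ 1, k ≥ 1, let A and B be nonempty curves in ℝ^d, let Π₁ be a (k,γ)-simplification of A and Π₂ a (k,γ)-simplification of B. Then Π₁∘Π₂ has length at most 2k, and for every curve Π of length at most k, dFr(A∘B, Π₁∘Π₂) ≤ γ·dFr(A∘B, Π). -/

import Mathlib

noncomputable section

abbrev Pt (d : ℕ) : Type := EuclideanSpace ℝ (Fin d)

/-- Cost contribution of a single pair of blocks: the maximum distance between a point
of `A` and a point of `B` (0 if one of them is empty). -/
def pairCost {d : ℕ} (A B : List (Pt d)) : ℝ :=
  (A.map fun p => (B.map fun q => dist p q).foldr max 0).foldr max 0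

/-- `ω` is a paired walk along `P` and `Q`: the first components partition `P` into
consecutive nonempty blocks, the second components partition `Q`, and in each pair at
least one block is a single point. -/
def IsPairedWalk {d : ℕ} (ω : List (List (Pt d) × List (Pt d))) (P Q : List (Pt d)) : Prop :=
  (ω.map Prod.fst).flatten = P ∧ (ω.map Prod.snd).flatten = Q ∧
    ∀ pr ∈ ω, pr.1 ≠ [] ∧ pr.2 ≠ [] ∧ (pr.1.length = 1 ∨ pr.2.length = 1)

/-- The cost of a paired walk: the maximum over its pairs of the maximum distance between
matched points. -/
def walkCost {d : ℕ} (ω : List (List (Pt d) × List (Pt d))) : ℝ :=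
  (ω.map fun pr => pairCost pr.1 pr.2).foldr max 0

/-- The discrete Fréchet distance: the minimum cost over all paired walks along `P` and `Q`. -/
def dFr {d : ℕ} (P Q : List (Pt d)) : ℝ :=
  sInf {c : ℝ | ∃ ω, IsPairedWalk ω P Q ∧ walkCost ω = c}

/-- `Γ` is a `(k,γ)`-simplification of `P`: a (nonempty) curve of length at most `k` such
that `dFr P Γ ≤ γ * dFr P Γ'` for every (nonempty) curve `Γ'` of length at most `k`. -/
def IsSimplification {d : ℕ} (k : ℕ) (γ : ℝ) (P Γ : List (Pt d)) : Prop :=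
  Γ ≠ [] ∧ Γ.length ≤ k ∧
    ∀ Γ' : List (Pt d), Γ' ≠ [] → Γ'.length ≤ k → dFr P Γ ≤ γ * dFr P Γ'

/-- Every cross pair of `pr` is within distance `c`. -/
def PairLe {d : ℕ} (c : ℝ) (pr : List (Pt d) × List (Pt d)) : Prop :=
  ∀ p ∈ pr.1, ∀ q ∈ pr.2, dist p q ≤ c

lemma foldr_max_le_iff (l : List ℝ) (c : ℝ) :
    l.foldr max 0 ≤ c ↔ 0 ≤ c ∧ ∀ x ∈ l, x ≤ c := by
  induction l with
  | nil => simp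
  | cons a l ih =>
    simp only [List.foldr_cons, max_le_iff, ih, List.mem_cons, forall_eq_or_imp]
    tauto

lemma pairCost_le_iff {d : ℕ} (A B : List (Pt d)) (c : ℝ) :
    pairCost A B ≤ c ↔ 0 ≤ c ∧ PairLe c (A, B) := by
  unfold pairCost PairLe
  rw [foldr_max_le_iff]
  simp only [List.mem_map, forall_exists_index, and_imp, forall_apply_eq_imp_iff₂,
    foldr_max_le_iff]
  constructor
  · rintro ⟨h0, h⟩
    exact ⟨h0, fun p hp => (h p hp).2⟩
  · rintro ⟨h0, h⟩
    exact ⟨h0, fun p hp => ⟨h0, h p hp⟩⟩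

lemma walkCost_le_iff {d : ℕ} (ω : List (List (Pt d) × List (Pt d))) (c : ℝ) :
    walkCost ω ≤ c ↔ 0 ≤ c ∧ ∀ pr ∈ ω, PairLe c pr := by
  unfold walkCost
  rw [foldr_max_le_iff]
  simp only [List.mem_map, forall_exists_index, and_imp, forall_apply_eq_imp_iff₂,
    pairCost_le_iff]
  constructor
  · rintro ⟨h0, h⟩
    exact ⟨h0, fun p hp => (h p hp).2⟩
  · rintro ⟨h0, h⟩
    exact ⟨h0, fun p hp => ⟨h0, h p hp⟩⟩

lemma walkCost_nonneg {d : ℕ} (ω : List (List (Pt d) × List (Pt d))) : 0 ≤ walkCost ω :=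
  ((walkCost_le_iff ω _).1 le_rfl).1

lemma dFr_le {d : ℕ} {P Q : List (Pt d)} {ω} (h : IsPairedWalk ω P Q) {c : ℝ}
    (hc : walkCost ω ≤ c) : dFr P Q ≤ c :=
  (csInf_le (s := {c : ℝ | ∃ ω, IsPairedWalk ω P Q ∧ walkCost ω = c})
    ⟨0, by rintro _ ⟨ω, -, rfl⟩; exact walkCost_nonneg ω⟩ ⟨ω, h, rfl⟩).trans hc

lemma exists_walk {d : ℕ} (P Q : List (Pt d)) (hP : P ≠ []) (hQ : Q ≠ []) :
    ∃ ω, IsPairedWalk ω P Q := by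
  induction P generalizing Q with
  | nil => exact absurd rfl hP
  | cons p P ih =>
    obtain ⟨q, Q, rfl⟩ := List.exists_cons_of_ne_nil hQ
    by_cases hP' : P = []
    · subst hP'
      exact ⟨[([p], q :: Q)], by simp [IsPairedWalk]⟩
    by_cases hQ' : Q = []
    · subst hQ'
      exact ⟨[(p :: P, [q])], by simp [IsPairedWalk]⟩
    obtain ⟨ω, h1, h2, h3⟩ := ih Q hP' hQ'
    refine ⟨([p], [q]) :: ω, by simp [h1], by simp [h2], ?_⟩
    intro pr hpr
    rcases List.mem_cons.1 hpr with rfl | h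
    · simp
    · exact h3 pr h

lemma exists_walk_lt {d : ℕ} {P Q : List (Pt d)} (hP : P ≠ []) (hQ : Q ≠ []) {c : ℝ}
    (hc : dFr P Q < c) : ∃ ω, IsPairedWalk ω P Q ∧ walkCost ω < c := by
  obtain ⟨ω, hω⟩ := exists_walk P Q hP hQ
  obtain ⟨_, ⟨ω', h, rfl⟩, hlt⟩ := exists_lt_of_csInf_lt
    (s := {c : ℝ | ∃ ω, IsPairedWalk ω P Q ∧ walkCost ω = c}) ⟨_, ω, hω, rfl⟩ hc
  exact ⟨ω', h, hlt⟩

lemma dFr_append_le {d : ℕ} {A B P Q : List (Pt d)} (hA : A ≠ []) (hB : B ≠ [])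
    (hP : P ≠ []) (hQ : Q ≠ []) {c : ℝ} (h1 : dFr A P ≤ c) (h2 : dFr B Q ≤ c) :
    dFr (A ++ B) (P ++ Q) ≤ c := by
  refine le_of_forall_gt_imp_ge_of_dense fun c' hc' => ?_
  obtain ⟨ω₁, ⟨a1, a2, a3⟩, hc1⟩ := exists_walk_lt hA hP (h1.trans_lt hc')
  obtain ⟨ω₂, ⟨b1, b2, b3⟩, hc2⟩ := exists_walk_lt hB hQ (h2.trans_lt hc')
  have e1 := (walkCost_le_iff _ _).1 hc1.le
  have e2 := (walkCost_le_iff _ _).1 hc2.le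
  refine dFr_le (ω := ω₁ ++ ω₂) ⟨by simp [a1, b1], by simp [a2, b2], ?_⟩
    ((walkCost_le_iff _ _).2 ⟨e1.1, ?_⟩)
  · intro pr hpr
    rcases List.mem_append.1 hpr with h | h
    exacts [a3 pr h, b3 pr h]
  · intro pr hpr
    rcases List.mem_append.1 hpr with h | h
    exacts [e1.2 pr h, e2.2 pr h]

lemma walk_ne_nil {d : ℕ} {ω} {P Q : List (Pt d)} (h : IsPairedWalk ω P Q) (hP : P ≠ []) :
    Q ≠ [] := by
  obtain ⟨h1, h2, h3⟩ := h
  cases ω with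
  | nil => exact absurd h1.symm hP
  | cons pr ω =>
    have := (h3 pr (by simp)).2.1
    rw [← h2]
    simp [this]

/-- A walk along `A ++ B` and `Q` splits into walks along `A` and along `B`. -/
lemma split_walk {d : ℕ} (c : ℝ) (ω : List (List (Pt d) × List (Pt d))) :
    ∀ (A B Q : List (Pt d)), A ≠ [] → B ≠ [] → IsPairedWalk ω (A ++ B) Q →
    (∀ pr ∈ ω, PairLe c pr) →
    ∃ ω₁ ω₂ Q₁ Q₂, IsPairedWalk ω₁ A Q₁ ∧ IsPairedWalk ω₂ B Q₂ ∧
      Q₁.length ≤ Q.length ∧ Q₂.length ≤ Q.length ∧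
      (∀ pr ∈ ω₁, PairLe c pr) ∧ (∀ pr ∈ ω₂, PairLe c pr) := by
  induction ω with
  | nil =>
    rintro A B Q hA hB ⟨h1, -, -⟩ -
    simp at h1
    exact absurd h1.1 hA
  | cons pr ω ih =>
    obtain ⟨X, Y⟩ := pr
    rintro A B Q hA hB ⟨h1, h2, h3⟩ hc
    simp only [List.map_cons, List.flatten_cons] at h1 h2
    have hpr := h3 (X, Y) (by simp)
    have hcpr := hc (X, Y) (by simp)
    have h3' : ∀ pr ∈ ω, pr.1 ≠ [] ∧ pr.2 ≠ [] ∧ (pr.1.length = 1 ∨ pr.2.length = 1) :=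
      fun pr h => h3 pr (List.mem_cons_of_mem _ h)
    have hc' : ∀ pr ∈ ω, PairLe c pr := fun pr h => hc pr (List.mem_cons_of_mem _ h)
    have hclean : X = A → (ω.map Prod.fst).flatten = B →
        ∃ ω₁ ω₂ Q₁ Q₂, IsPairedWalk ω₁ A Q₁ ∧ IsPairedWalk ω₂ B Q₂ ∧
          Q₁.length ≤ Q.length ∧ Q₂.length ≤ Q.length ∧
          (∀ pr ∈ ω₁, PairLe c pr) ∧ (∀ pr ∈ ω₂, PairLe c pr) := by
      rintro rfl hB'
      refine ⟨[(X, Y)], ω, Y, _, ⟨by simp, by simp, ?_⟩, ⟨hB', rfl, h3'⟩, ?_, ?_, ?_, hc'⟩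
      · intro pr h
        rw [List.mem_singleton.1 h]
        exact hpr
      · rw [← h2, List.length_append]; omega
      · rw [← h2, List.length_append]; omega
      · intro pr h
        rw [List.mem_singleton.1 h]
        exact hcpr
    rcases List.append_eq_append_iff.1 h1 with ⟨A', hA', hr⟩ | ⟨C, hX, hB'⟩
    · by_cases hn : A' = []
      · subst hn
        exact hclean (by simpa using hA'.symm) (by simpa using hr)
      obtain ⟨ω₁, ω₂, Q₁, Q₂, w1, w2, l1, l2, c1, c2⟩ :=
        ih A' B _ hn hB ⟨hr, rfl, h3'⟩ hc'
      refine ⟨(X, Y) :: ω₁, ω₂, Y ++ Q₁, Q₂,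
        ⟨by simp [w1.1, hA'], by simp [w1.2.1], ?_⟩, w2, ?_, ?_, ?_, c2⟩
      · intro pr h
        rcases List.mem_cons.1 h with rfl | h
        exacts [hpr, w1.2.2 pr h]
      · rw [← h2, List.length_append, List.length_append]; omega
      · rw [← h2, List.length_append]; omega
      · intro pr h
        rcases List.mem_cons.1 h with rfl | h
        exacts [hcpr, c1 pr h]
    · by_cases hn : C = []
      · subst hn
        exact hclean (by simpa using hX) (by simpa using hB'.symm)
      have hA1 := List.length_pos_iff.2 hA
      have hC1 := List.length_pos_iff.2 hn
      have hY : Y.length = 1 := by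
        rcases hpr.2.2 with h | h
        · simp only [hX, List.length_append] at h
          omega
        · exact h
      refine ⟨[(A, Y)], (C, Y) :: ω, Y, Q, ⟨by simp, by simp, ?_⟩,
        ⟨by simp [hB'], by simp [h2], ?_⟩, ?_, le_rfl, ?_, ?_⟩
      · intro pr h
        rw [List.mem_singleton.1 h]
        exact ⟨hA, hpr.2.1, Or.inr hY⟩
      · intro pr h
        rcases List.mem_cons.1 h with rfl | h
        exacts [⟨hn, hpr.2.1, Or.inr hY⟩, h3' pr h]
      · rw [← h2, List.length_append]; omega
      · intro pr h
        rw [List.mem_singleton.1 h]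
        exact fun p hp q hq => hcpr p (by simp_all) q hq
      · intro pr h
        rcases List.mem_cons.1 h with rfl | h
        · exact fun p hp q hq => hcpr p (by simp_all) q hq
        · exact hc' pr h

/-- Concatenating a `(k,γ)`-simplification `Γ₁` of `A` with a `(k,γ)`-simplification `Γ₂`
of `B` yields a curve of length at most `2k` which is within factor `γ` of every curve of
length at most `k` with respect to `A ∘ B`. -/
theorem concat_simplification {d : ℕ} (γ : ℝ) (hγ : 1 ≤ γ) (k : ℕ) (hk : 1 ≤ k)
    (A B : List (Pt d)) (hA : A ≠ []) (hB : B ≠ [])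
    (Γ₁ Γ₂ : List (Pt d)) (hΓ₁ : IsSimplification k γ A Γ₁) (hΓ₂ : IsSimplification k γ B Γ₂) :
    (Γ₁ ++ Γ₂).length ≤ 2 * k ∧
    ∀ Γ : List (Pt d), Γ ≠ [] → Γ.length ≤ k →
      dFr (A ++ B) (Γ₁ ++ Γ₂) ≤ γ * dFr (A ++ B) Γ := by
  refine ⟨by rw [List.length_append]; have := hΓ₁.2.1; have := hΓ₂.2.1; omega, ?_⟩
  intro Γ hΓ hlen
  have hγ0 : 0 < γ := by linarith
  rw [← div_le_iff₀' hγ0]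
  refine le_of_forall_gt_imp_ge_of_dense fun c hc => ?_
  rw [div_le_iff₀' hγ0]
  obtain ⟨ω, hω, hlt⟩ := exists_walk_lt (by simp [hA]) hΓ hc
  obtain ⟨h0, hp⟩ := (walkCost_le_iff _ _).1 hlt.le
  obtain ⟨ω₁, ω₂, Q₁, Q₂, w1, w2, l1, l2, c1, c2⟩ := split_walk c ω A B Γ hA hB hω hp
  refine dFr_append_le hA hB hΓ₁.1 hΓ₂.1 ?_ ?_
  · exact (hΓ₁.2.2 Q₁ (walk_ne_nil w1 hA) (l1.trans hlen)).trans
      (mul_le_mul_of_nonneg_left (dFr_le w1 ((walkCost_le_iff _ _).2 ⟨h0, c1⟩)) hγ0.le)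
  · exact (hΓ₂.2.2 Q₂ (walk_ne_nil w2 hB) (l2.trans hlen)).trans
      (mul_le_mul_of_nonneg_left (dFr_le w2 ((walkCost_le_iff _ _).2 ⟨h0, c2⟩)) hγ0.le)
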